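/- arXiv:1702.05473 — 3 statements merged into one kernel-verified Lean document; each statement's English description precedes it below -/
import Mathlib

section
/- Gilbert–Welch construction W2(p, φ): Let p > 3 be prime and let φ be a primitive element of the finite field F_p. Then the (p−2)×(p−2) array (s_{i,j}) given by s_{i,j} = I[i = φ^j − 1] for i, j ∈ {1, 2, …, p−2}, where the equation is over F_p (with i interpreted as its residue in F_p), is an order p−2 Costas array. -/
/-- An order `n` permutation array: an `n × n` array with entries in `{0,1}`,
indexed by `{1, …, n}`, such that every row and every column contains exactly one `1`. -/
def IsPermArray (n : ℕ) (s : ℕ → ℕ → ℕ) : Prop :=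
  (∀ i ∈ Finset.Icc 1 n, ∀ j ∈ Finset.Icc 1 n, s i j = 0 ∨ s i j = 1) ∧
  (∀ i ∈ Finset.Icc 1 n, ∑ j ∈ Finset.Icc 1 n, s i j = 1) ∧
  (∀ j ∈ Finset.Icc 1 n, ∑ i ∈ Finset.Icc 1 n, s i j = 1)

/-- An order `n` Costas array: a permutation array in which the vectors joining
pairs of `1` entries are all distinct. -/
def IsCostasArray (n : ℕ) (s : ℕ → ℕ → ℕ) : Prop :=
  IsPermArray n s ∧
  ∀ i1 ∈ Finset.Icc 1 n, ∀ j1 ∈ Finset.Icc 1 n,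
  ∀ i2 ∈ Finset.Icc 1 n, ∀ j2 ∈ Finset.Icc 1 n,
  ∀ i3 ∈ Finset.Icc 1 n, ∀ j3 ∈ Finset.Icc 1 n,
  ∀ i4 ∈ Finset.Icc 1 n, ∀ j4 ∈ Finset.Icc 1 n,
    s i1 j1 = 1 → s i2 j2 = 1 → s i3 j3 = 1 → s i4 j4 = 1 →
    ((i2 : ℤ) - (i1 : ℤ), (j2 : ℤ) - (j1 : ℤ)) =
      ((i4 : ℤ) - (i3 : ℤ), (j4 : ℤ) - (j3 : ℤ)) →
    ((i2 : ℤ) - (i1 : ℤ), (j2 : ℤ) - (j1 : ℤ)) ≠ (0, 0) →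
    (i1, j1) = (i3, j3)

/-- A primitive element of a finite field: a generator of its multiplicative group. -/
def IsPrimitiveElt {F : Type*} [Field F] [Fintype F] (φ : F) : Prop :=
  orderOf φ = Fintype.card F - 1

/-- The sum of the indicator of a property that holds at exactly one element is `1`. -/
theorem Finset.sum_indicator_eq_one {α : Type*} {s : Finset α} {P : α → Prop} [DecidablePred P]
    {a : α} (ha : a ∈ s) (hP : P a) (huniq : ∀ b ∈ s, P b → b = a) :
    ∑ b ∈ s, (if P b then 1 else 0) = 1 := by
  rw [Finset.sum_eq_single_of_mem a ha fun b hb hne => if_neg fun h => hne (huniq b hb h),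
    if_pos hP]

/-- Two pairs in a commutative ring without zero divisors with the same sum and the same product
coincide up to order. -/
theorem eq_or_eq_of_add_eq_of_mul_eq {R : Type*} [CommRing R] [NoZeroDivisors R] {a b c d : R}
    (hadd : a + b = c + d) (hmul : a * b = c * d) : a = c ∨ a = d := by
  have h : (a - c) * (a - d) = 0 := by linear_combination a * hadd - hmul
  exact (mul_eq_zero.mp h).imp sub_eq_zero.mp sub_eq_zero.mp

theorem ZMod.natCast_inj_of_lt {p a b : ℕ} (ha : a < p) (hb : b < p)
    (h : (a : ZMod p) = b) : a = b :=
  Nat.ModEq.eq_of_lt_of_lt ((ZMod.natCast_eq_natCast_iff a b p).mp h) ha hb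

namespace IsPrimitiveElt

variable {p : ℕ} [Fact p.Prime] {φ : ZMod p}

theorem isPrimitiveRoot (hφ : IsPrimitiveElt φ) : IsPrimitiveRoot φ (p - 1) := by
  have h : orderOf φ = p - 1 := by rw [hφ, ZMod.card]
  exact h ▸ IsPrimitiveRoot.orderOf φ

theorem exists_pow_eq (hφ : IsPrimitiveElt φ) {x : ZMod p} (hx : x ≠ 0) :
    ∃ j < p - 1, φ ^ j = x := by
  have : NeZero (p - 1) := ⟨Nat.sub_ne_zero_of_lt (Fact.out : p.Prime).one_lt⟩
  exact hφ.isPrimitiveRoot.eq_pow_of_pow_eq_one (ZMod.pow_card_sub_one_eq_one hx)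

theorem ne_zero (hφ : IsPrimitiveElt φ) : φ ≠ 0 :=
  hφ.isPrimitiveRoot.ne_zero (Nat.sub_ne_zero_of_lt (Fact.out : p.Prime).one_lt)

end IsPrimitiveElt

/-- The Gilbert–Welch array `I[i = φ ^ j - 1]` is a permutation array. -/
theorem isPermArray_gilbert_welch_W2 (p : ℕ) [Fact p.Prime] (φ : ZMod p)
    (hφ : IsPrimitiveElt φ) :
    IsPermArray (p - 2)
      (fun i j => if (i : ZMod p) = φ ^ j - 1 then 1 else 0) := by
  refine ⟨fun i _ j _ => (ite_eq_or_eq _ _ _).symm, fun i hi => ?_, fun j hj => ?_⟩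
  · rw [Finset.mem_Icc] at hi
    have hi1 : ((i + 1 : ℕ) : ZMod p) ≠ 0 := fun h =>
      i.succ_ne_zero <|
        ZMod.natCast_inj_of_lt (p := p) (a := i + 1) (b := 0) (by omega) (by omega)
          (by simpa using h)
    obtain ⟨j, hj, hji⟩ := hφ.exists_pow_eq hi1
    have hj0 : j ≠ 0 := by
      rintro rfl
      have h : (i : ZMod p) = (0 : ℕ) := by push_cast at hji ⊢; linear_combination -hji
      have := ZMod.natCast_inj_of_lt (by omega) (by omega) h
      omega
    refine Finset.sum_indicator_eq_one (Finset.mem_Icc.mpr (by omega : 1 ≤ j ∧ j ≤ p - 2))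
      (by rw [hji]; push_cast; ring) fun k hk hki => ?_
    rw [Finset.mem_Icc] at hk
    refine hφ.isPrimitiveRoot.pow_inj (by omega) hj ?_
    push_cast at hji
    linear_combination -hki - hji
  · rw [Finset.mem_Icc] at hj
    have hval : ((φ ^ j - 1).val : ZMod p) = φ ^ j - 1 := ZMod.natCast_zmod_val _
    have hlt := ZMod.val_lt (φ ^ j - 1)
    have hne0 : (φ ^ j - 1).val ≠ 0 := fun h =>
      hφ.isPrimitiveRoot.pow_ne_one_of_pos_of_lt (by omega) (by omega)
        (sub_eq_zero.mp ((ZMod.val_eq_zero _).mp h))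
    have hne : (φ ^ j - 1).val ≠ p - 1 := fun h => by
      rw [h, Nat.cast_sub (by omega), ZMod.natCast_self] at hval
      exact pow_ne_zero j hφ.ne_zero (by push_cast at hval; linear_combination -hval)
    refine Finset.sum_indicator_eq_one
      (Finset.mem_Icc.mpr (by omega : 1 ≤ (φ ^ j - 1).val ∧ (φ ^ j - 1).val ≤ p - 2))
      hval fun k hk hkj => ?_
    rw [Finset.mem_Icc] at hk
    exact ZMod.natCast_inj_of_lt (by omega) hlt (hkj.trans hval.symm)

/-- Gilbert–Welch construction `W₂(p, φ)`: for a prime `p > 3` and a primitive element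
`φ` of `𝔽_p`, the array `s i j = I[i = φ^j − 1]` for `i, j ∈ {1, …, p−2}`
is an order `p − 2` Costas array. -/
theorem gilbert_welch_W2 (p : ℕ) [Fact p.Prime] (hp : 3 < p) (φ : ZMod p)
    (hφ : IsPrimitiveElt φ) :
    IsCostasArray (p - 2)
      (fun i j => if (i : ZMod p) = φ ^ j - 1 then 1 else 0) := by
  refine ⟨isPermArray_gilbert_welch_W2 p φ hφ, ?_⟩
  intro i1 hi1 j1 hj1 i2 hi2 j2 hj2 i3 hi3 j3 hj3 i4 hi4 j4 hj4 h1 h2 h3 h4 heq hne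
  simp only [Finset.mem_Icc] at hi1 hj1 hi2 hj2 hi3 hj3 hi4 hj4
  simp only [ite_eq_left_iff, zero_ne_one, imp_false, not_not] at h1 h2 h3 h4
  simp only [Prod.mk.injEq, ne_eq] at heq hne ⊢
  have hi : i2 + i3 = i4 + i1 := by omega
  have hj : j2 + j3 = j4 + j1 := by omega
  have hadd : φ ^ j2 + φ ^ j3 = φ ^ j4 + φ ^ j1 := by
    have h := congrArg (Nat.cast : ℕ → ZMod p) hi
    push_cast at h
    linear_combination h - h2 - h3 + h4 + h1
  have hmul : φ ^ j2 * φ ^ j3 = φ ^ j4 * φ ^ j1 := by rw [← pow_add, ← pow_add, hj]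
  rcases eq_or_eq_of_add_eq_of_mul_eq hadd hmul with h | h
  · have := ZMod.natCast_inj_of_lt (by omega) (by omega)
      (show (i2 : ZMod p) = i4 by rw [h2, h4, h])
    have := hφ.isPrimitiveRoot.pow_inj (by omega) (by omega) h
    omega
  · have := ZMod.natCast_inj_of_lt (by omega) (by omega)
      (show (i2 : ZMod p) = i1 by rw [h2, h1, h])
    have := hφ.isPrimitiveRoot.pow_inj (by omega) (by omega) h
    omega
end

section
/- Theorem (first Costas cube family): Let q > 3 be a prime power, and let φ, ρ, ψ be (not necessarily distinct) primitive elements of the finite field F_q. Then the (q−2)×(q−2)×(q−2) array D = (d_{i,j,k}) given by d_{i,j,k} = I[φ^i + ρ^{−j} = 1 and φ^{−i} + ψ^k = 1 and ρ^j + ψ^{−k} = 1] for i, j, k ∈ {1, 2, …, q−2}, where the equations are over F_q, is an order q−2 Costas cube; moreover Projection A of D is the array (I[φ^i + ρ^{−j} = 1]) (the G2(q, φ, ρ^{−1}) Golomb Costas array), Projection B of D is the array (I[φ^{−i} + ψ^k = 1]) (the G2(q, φ^{−1}, ψ) Golomb Costas array), and Projection C of D is the array (I[ρ^j + ψ^{−k}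 = 1]) (the G2(q, ρ, ψ^{−1}) Golomb Costas array). -/
/-- Projection A of a three-dimensional array: `a i j = ∑ k, d i j k`. -/
def ProjA (n : ℕ) (d : ℕ → ℕ → ℕ → ℕ) (i j : ℕ) : ℕ := ∑ k ∈ Finset.Icc 1 n, d i j k

/-- Projection B of a three-dimensional array: `b i k = ∑ j, d i j k`. -/
def ProjB (n : ℕ) (d : ℕ → ℕ → ℕ → ℕ) (i k : ℕ) : ℕ := ∑ j ∈ Finset.Icc 1 n, d i j k

/-- Projection C of a three-dimensional array: `c j k = ∑ i, d i j k`. -/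
def ProjC (n : ℕ) (d : ℕ → ℕ → ℕ → ℕ) (j k : ℕ) : ℕ := ∑ i ∈ Finset.Icc 1 n, d i j k

/-- An order `n` Costas cube: an `n × n × n` array over `ℤ₂` whose three
projections are each order `n` Costas arrays. -/
def IsCostasCube (n : ℕ) (d : ℕ → ℕ → ℕ → ℕ) : Prop :=
  (∀ i ∈ Finset.Icc 1 n, ∀ j ∈ Finset.Icc 1 n, ∀ k ∈ Finset.Icc 1 n,
      d i j k = 0 ∨ d i j k = 1) ∧
  IsCostasArray n (ProjA n d) ∧ IsCostasArray n (ProjB n d) ∧ IsCostasArray n (ProjC n d)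

namespace IsPrimitiveElt

variable {F : Type*} [Field F] [Fintype F] {α β : F}

theorem ne_zero_s7 (h : IsPrimitiveElt α) : α ≠ 0 := by
  rintro rfl
  have hcard := Fintype.one_lt_card (α := F)
  have h0 : orderOf (0 : F) = Fintype.card F - 1 := h
  rw [orderOf_zero] at h0
  omega

theorem inv (h : IsPrimitiveElt α) : IsPrimitiveElt α⁻¹ := by
  have hu : orderOf (Units.mk0 α h.ne_zero_s7)⁻¹ = Fintype.card F - 1 := by
    rw [orderOf_inv, ← orderOf_units, Units.val_mk0]
    exact h
  rw [← orderOf_units, Units.val_inv_eq_inv_val, Units.val_mk0] at hu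
  exact hu

theorem pow_ne_one (h : IsPrimitiveElt α) {i : ℕ}
    (hi : i ∈ Finset.Icc 1 (Fintype.card F - 2)) : α ^ i ≠ 1 := by
  have ho : orderOf α = Fintype.card F - 1 := h
  rw [Finset.mem_Icc] at hi
  exact pow_ne_one_of_lt_orderOf (by omega) (by omega)

theorem pow_inj (h : IsPrimitiveElt α) {i j : ℕ}
    (hi : i ∈ Finset.Icc 1 (Fintype.card F - 2)) (hj : j ∈ Finset.Icc 1 (Fintype.card F - 2))
    (hij : α ^ i = α ^ j) : i = j := by
  have ho : orderOf α = Fintype.card F - 1 := h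
  rw [Finset.mem_Icc] at hi hj
  exact pow_injOn_Iio_orderOf (Set.mem_Iio.2 (by omega)) (Set.mem_Iio.2 (by omega)) hij

theorem exists_pow_eq_s7 (h : IsPrimitiveElt α) {x : F} (h0 : x ≠ 0) (h1 : x ≠ 1) :
    ∃ i ∈ Finset.Icc 1 (Fintype.card F - 2), α ^ i = x := by
  have ho : orderOf α = Fintype.card F - 1 := h
  have hcard := Fintype.one_lt_card (α := F)
  have : NeZero (orderOf α) := ⟨by omega⟩
  obtain ⟨i, hi, rfl⟩ := (IsPrimitiveRoot.orderOf α).eq_pow_of_pow_eq_one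
    (ξ := x) (by rw [ho]; exact FiniteField.pow_card_sub_one_eq_one x h0)
  have hi0 : i ≠ 0 := by
    rintro rfl
    exact h1 (pow_zero α)
  exact ⟨i, Finset.mem_Icc.2 ⟨by omega, by omega⟩, rfl⟩

theorem sum_ite_pow_eq [DecidableEq F] (h : IsPrimitiveElt α) {x : F} (h0 : x ≠ 0)
    (h1 : x ≠ 1) :
    ∑ i ∈ Finset.Icc 1 (Fintype.card F - 2), (if α ^ i = x then 1 else 0) = 1 := by
  obtain ⟨m, hm, hmx⟩ := h.exists_pow_eq_s7 h0 h1
  rw [Finset.sum_eq_single_of_mem m hm, if_pos hmx]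
  intro i hi him
  exact if_neg fun hix => him (h.pow_inj hi hm (hix.trans hmx.symm))

/-- The Golomb array `G₂(q, α, β)` is a Costas array. -/
theorem isCostasArray_golomb [DecidableEq F] (hα : IsPrimitiveElt α) (hβ : IsPrimitiveElt β) :
    IsCostasArray (Fintype.card F - 2) fun i j => if α ^ i + β ^ j = 1 then 1 else 0 := by
  refine ⟨⟨fun i _ j _ => ?_, fun i hi => ?_, fun j hj => ?_⟩, ?_⟩
  · dsimp only
    split_ifs <;> simp
  · simp_rw [← eq_sub_iff_add_eq']
    refine hβ.sum_ite_pow_eq (sub_ne_zero.2 (hα.pow_ne_one hi).symm) ?_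
    simp [hα.ne_zero_s7]
  · simp_rw [← eq_sub_iff_add_eq]
    refine hα.sum_ite_pow_eq (sub_ne_zero.2 (hβ.pow_ne_one hj).symm) ?_
    simp [hβ.ne_zero_s7]
  · intro i1 hi1 j1 hj1 i2 hi2 j2 hj2 i3 hi3 j3 hj3 i4 hi4 j4 hj4 h1 h2 h3 h4 heq hne
    simp only [ite_eq_left_iff, zero_ne_one, imp_false, not_not] at h1 h2 h3 h4
    rw [Prod.mk.injEq] at heq
    have hi : i2 + i3 = i1 + i4 := by omega
    have hj : j2 + j3 = j1 + j4 := by omega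
    have ha : α ^ i2 * α ^ i3 = α ^ i1 * α ^ i4 := by rw [← pow_add, hi, pow_add]
    have hb : β ^ j2 * β ^ j3 = β ^ j1 * β ^ j4 := by rw [← pow_add, hj, pow_add]
    have hprod : (α ^ i2 - α ^ i1) * (α ^ i3 - α ^ i1) = 0 := by
      rw [← eq_sub_iff_add_eq'] at h1 h2 h3 h4
      rw [h1, h2, h3, h4] at hb
      linear_combination (1 - α ^ i1) * ha + α ^ i1 * hb
    rcases mul_eq_zero.1 hprod with h | h
    · have ha2 := sub_eq_zero.1 h
      have hb2 : β ^ j2 = β ^ j1 := by linear_combination h2 - h1 - ha2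
      refine absurd ?_ hne
      rw [hα.pow_inj hi2 hi1 ha2, hβ.pow_inj hj2 hj1 hb2, sub_self, sub_self]
    · have ha3 := sub_eq_zero.1 h
      have hb3 : β ^ j3 = β ^ j1 := by linear_combination h3 - h1 - ha3
      rw [hα.pow_inj hi3 hi1 ha3, hβ.pow_inj hj3 hj1 hb3]

end IsPrimitiveElt

theorem IsCostasArray.congr {n : ℕ} {s t : ℕ → ℕ → ℕ} (hs : IsCostasArray n s)
    (hst : ∀ i ∈ Finset.Icc 1 n, ∀ j ∈ Finset.Icc 1 n, t i j = s i j) : IsCostasArray n t := by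
  obtain ⟨⟨h01, hrow, hcol⟩, hvec⟩ := hs
  refine ⟨⟨fun i hi j hj => hst i hi j hj ▸ h01 i hi j hj, fun i hi => ?_, fun j hj => ?_⟩, ?_⟩
  · rw [Finset.sum_congr rfl (hst i hi), hrow i hi]
  · rw [Finset.sum_congr rfl fun i hi => hst i hi j hj, hcol j hj]
  · intro i1 hi1 j1 hj1 i2 hi2 j2 hj2 i3 hi3 j3 hj3 i4 hi4 j4 hj4
    rw [hst i1 hi1 j1 hj1, hst i2 hi2 j2 hj2, hst i3 hi3 j3 hj3, hst i4 hi4 j4 hj4]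
    exact hvec i1 hi1 j1 hj1 i2 hi2 j2 hj2 i3 hi3 j3 hj3 i4 hi4 j4 hj4

/-- The relation `x + y⁻¹ = 1 ∧ x⁻¹ + z = 1 ∧ y + z⁻¹ = 1` is determined by its first equation
and `z = 1 - x⁻¹`. -/
theorem costas_relation_iff {F : Type*} [Field F] {x y z : F} (hx : x ≠ 0) (hy : y ≠ 0)
    (hz : z ≠ 0) :
    (x + y⁻¹ = 1 ∧ x⁻¹ + z = 1 ∧ y + z⁻¹ = 1) ↔ x + y⁻¹ = 1 ∧ z = 1 - x⁻¹ := by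
  rw [← eq_sub_iff_add_eq' (a := z)]
  refine and_congr_right fun h => and_iff_left_of_imp fun h' => ?_
  field_simp at h h' ⊢
  refine mul_left_cancel₀ hx ?_
  linear_combination (y - 1) * h' + h

theorem sum_ite_and_eq {ι : Type*} (s : Finset ι) (p : Prop) [Decidable p] (r t : ι → Prop)
    [DecidablePred r] [DecidablePred t] (h : ∀ i ∈ s, r i ↔ p ∧ t i)
    (ht : ∑ i ∈ s, (if t i then 1 else 0) = 1) :
    ∑ i ∈ s, (if r i then 1 else 0) = if p then 1 else 0 := by
  split_ifs with hp
  · exact (Finset.sum_congr rfl fun i hi => by simp [h i hi, hp]).trans ht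
  · exact Finset.sum_eq_zero fun i hi => if_neg fun hr => hp ((h i hi).1 hr).1

/-- First Costas cube family: for a prime power `q > 3` and primitive elements
`φ, ρ, ψ` of `𝔽_q`, the array
`d i j k = I[φ^i + ρ^(−j) = 1 ∧ φ^(−i) + ψ^k = 1 ∧ ρ^j + ψ^(−k) = 1]`
for `i, j, k ∈ {1, …, q−2}` is an order `q − 2` Costas cube, whose Projections
A, B, C are the `G₂(q, φ, ρ⁻¹)`, `G₂(q, φ⁻¹, ψ)`, `G₂(q, ρ, ψ⁻¹)` Golomb Costas
arrays respectively. -/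
theorem first_costas_cube_family (q : ℕ) (hq : 3 < q) (F : Type*) [Field F] [Fintype F]
    [DecidableEq F] (hcard : Fintype.card F = q) (φ ρ ψ : F)
    (hφ : IsPrimitiveElt φ) (hρ : IsPrimitiveElt ρ) (hψ : IsPrimitiveElt ψ)
    (d : ℕ → ℕ → ℕ → ℕ)
    (hd : d = fun (i j k : ℕ) =>
      if φ ^ i + ρ ^ (-(j : ℤ)) = 1 ∧ φ ^ (-(i : ℤ)) + ψ ^ k = 1 ∧
          ρ ^ j + ψ ^ (-(k : ℤ)) = 1 then 1 else 0) :
    IsCostasCube (q - 2) d ∧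
    (∀ i ∈ Finset.Icc 1 (q - 2), ∀ j ∈ Finset.Icc 1 (q - 2),
      ProjA (q - 2) d i j = if φ ^ i + ρ ^ (-(j : ℤ)) = 1 then 1 else 0) ∧
    (∀ i ∈ Finset.Icc 1 (q - 2), ∀ k ∈ Finset.Icc 1 (q - 2),
      ProjB (q - 2) d i k = if φ ^ (-(i : ℤ)) + ψ ^ k = 1 then 1 else 0) ∧
    (∀ j ∈ Finset.Icc 1 (q - 2), ∀ k ∈ Finset.Icc 1 (q - 2),
      ProjC (q - 2) d j k = if ρ ^ j + ψ ^ (-(k : ℤ)) = 1 then 1 else 0) := by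
  subst hcard hd
  have hpow {α : F} (hα : IsPrimitiveElt α) (i : ℕ) : α ^ i ≠ 0 := pow_ne_zero i hα.ne_zero_s7
  have hinv0 {α : F} (hα : IsPrimitiveElt α) {i : ℕ}
      (hi : i ∈ Finset.Icc 1 (Fintype.card F - 2)) : 1 - (α ^ i)⁻¹ ≠ 0 :=
    sub_ne_zero.2 (inv_ne_one.2 (hα.pow_ne_one hi)).symm
  have hinv1 {α : F} (hα : IsPrimitiveElt α) (i : ℕ) : 1 - (α ^ i)⁻¹ ≠ 1 := by
    simp [hα.ne_zero_s7]
  simp only [zpow_neg, zpow_natCast]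
  refine (and_iff_right_of_imp fun hABC => ⟨?_, ?_, ?_, ?_⟩).2
    ⟨fun i hi j hj => ?_, fun i hi k hk => ?_, fun j hj k hk => ?_⟩
  · exact sum_ite_and_eq _ _ _ _
      (fun k _ => costas_relation_iff (hpow hφ i) (hpow hρ j) (hpow hψ k))
      (hψ.sum_ite_pow_eq (hinv0 hφ hi) (hinv1 hφ i))
  · refine sum_ite_and_eq _ _ _ _ (fun j _ => ?_)
      (hρ.sum_ite_pow_eq (hinv0 hψ hk) (hinv1 hψ k))
    have h := costas_relation_iff (hpow hψ k) (hpow hφ i) (hpow hρ j)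
    grind
  · refine sum_ite_and_eq _ _ _ _ (fun i _ => ?_)
      (hφ.sum_ite_pow_eq (hinv0 hρ hj) (hinv1 hρ j))
    have h := costas_relation_iff (hpow hρ j) (hpow hψ k) (hpow hφ i)
    grind
  · intro i _ j _ k _
    dsimp only
    split_ifs <;> simp
  · refine (hφ.isCostasArray_golomb hρ.inv).congr ?_
    simpa only [inv_pow] using hABC.1
  · refine (hφ.inv.isCostasArray_golomb hψ).congr ?_
    simpa only [inv_pow] using hABC.2.1
  · refine (hρ.isCostasArray_golomb hψ.inv).congr ?_
    simpa only [inv_pow] using hABC.2.2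
end

section
/- Let q > 3 be a prime power and let φ be a primitive element of the finite field F_q such that both 1 − φ and 1 − φ^{−1} are primitive. Let (s'_{j,k}) be the order q−3 G3(q, (1−φ)^{−1}) Golomb Costas array, given by s'_{j,k} = I[((1−φ)^{−1})^{j+1} + (1 − (1−φ)^{−1})^{k+1} = 1] for j, k ∈ {1, …, q−3}, and let (r'_{j,k}) be its rotation through 180°, defined by r'_{j,k} = s'_{q−2−j, q−2−k}. Then r'_{j,k} = I[(1−φ)^j + (1−φ^{−1})^k = 1] for all j, k ∈ {1, …, q−3}. -/
theorem IsPrimitiveElt.ne_zero_s13 {F : Type*} [Field F] [Fintype F] {x : F}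
    (hx : IsPrimitiveElt x) : x ≠ 0 := by
  rintro rfl
  have h : 1 < Fintype.card F := Fintype.one_lt_card
  rw [IsPrimitiveElt, orderOf_zero] at hx
  omega

theorem inv_pow_eq_pow_of_add_eq_card_sub_one {F : Type*} [Field F] [Fintype F] {x : F}
    (hx : x ≠ 0) {m n : ℕ} (h : m + n = Fintype.card F - 1) : x⁻¹ ^ m = x ^ n := by
  rw [inv_pow, inv_eq_iff_eq_inv]
  apply eq_inv_of_mul_eq_one_left
  rw [← pow_add, h, FiniteField.pow_card_sub_one_eq_one x hx]

theorem one_sub_inv_one_sub {F : Type*} [Field F] {x : F} (h0 : x ≠ 0) (h1 : 1 - x ≠ 0) :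
    1 - (1 - x)⁻¹ = (1 - x⁻¹)⁻¹ := by
  have h2 : x - 1 ≠ 0 := by rwa [← neg_sub, neg_ne_zero]
  have h3 : 1 - x⁻¹ = (x - 1) / x := by field_simp
  rw [h3, inv_div, ← neg_sub x 1, inv_neg]
  field_simp
  ring

/-- For a prime power `q > 3` and a primitive element `φ` of `𝔽_q` with `1 − φ` and
`1 − φ⁻¹` also primitive, the rotation through 180° `r' j k = s' (q−2−j) (q−2−k)`
of the `G₃(q, (1−φ)⁻¹)` Golomb Costas array
`s' j k = I[((1−φ)⁻¹)^(j+1) + (1 − (1−φ)⁻¹)^(k+1) = 1]` satisfies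
`r' j k = I[(1−φ)^j + (1−φ⁻¹)^k = 1]` for all `j, k ∈ {1, …, q−3}`. -/
theorem rotation_of_G3 (q : ℕ) (hq : 3 < q) (F : Type*) [Field F] [Fintype F]
    [DecidableEq F] (hcard : Fintype.card F = q) (φ : F)
    (hφ : IsPrimitiveElt φ) (hφ1 : IsPrimitiveElt (1 - φ))
    (hφ2 : IsPrimitiveElt (1 - φ⁻¹))
    (s' r' : ℕ → ℕ → ℕ)
    (hs : ∀ j k, s' j k =
      if ((1 - φ)⁻¹) ^ (j + 1) + (1 - (1 - φ)⁻¹) ^ (k + 1) = 1 then 1 else 0)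
    (hr : ∀ j k, r' j k = s' (q - 2 - j) (q - 2 - k)) :
    ∀ j ∈ Finset.Icc 1 (q - 3), ∀ k ∈ Finset.Icc 1 (q - 3),
      r' j k = if (1 - φ) ^ j + (1 - φ⁻¹) ^ k = 1 then 1 else 0 := by
  intro j hj k hk
  rw [Finset.mem_Icc] at hj hk
  rw [hr, hs, one_sub_inv_one_sub hφ.ne_zero_s13 hφ1.ne_zero_s13,
    inv_pow_eq_pow_of_add_eq_card_sub_one hφ1.ne_zero_s13 (n := j) (by omega),
    inv_pow_eq_pow_of_add_eq_card_sub_one hφ2.ne_zero_s13 (n := k) (by omega)]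
end
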